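/- arXiv:2601.08039 — 2 statements merged into one kernel-verified Lean document; each statement's English description precedes it below -/
import Mathlib

section
/- Let A ∈ ℝ^{d×d} be symmetric positive definite and let L ∈ ℝ^{d×d} be an invertible matrix with Lᵀ A L = I_d. Let C := {v ∈ ℝ^d : vᵀ A v = 1}, and let σ_{S^{d−1}} and σ_C denote the (d−1)-dimensional Hausdorff measures on S^{d−1} and on C respectively. Then for every Borel set E ⊆ C, ∫_{ {s ∈ S^{d−1} : L·s ∈ E}} √((L s)ᵀ A² (L s)) dσ_{S^{d−1}}(s) = (1/|det L|) · σ_C(E). In particular, the pushforward under L of the measure with density s ↦ ‖A L s‖₂ with respect to σ_{S^{d−1}} is a constant multiple of σ_C, so reweighting the uniform proposal on S^{d−1} by the acceptance weight √(vᵀ A² v) (with v = L s) yields the uniform distribution on C. -/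
open Matrix MeasureTheory

/-- Reinterpret a plain vector `Fin d → ℝ` as a point of Euclidean space. -/
noncomputable def toE {d : ℕ} (x : Fin d → ℝ) : EuclideanSpace ℝ (Fin d) :=
  (EuclideanSpace.equiv (Fin d) ℝ).symm x

open Module ENNReal NNReal Filter Topology

/-- If distances between values of `f` on `s` are controlled by distances between values of `g`,
then so are the Hausdorff measures of the images. -/
theorem hausdorffMeasure_image_le_of_dist_le {X Y Z : Type*} [MetricSpace Y] [MetricSpace Z]
    [MeasurableSpace Y] [BorelSpace Y] [MeasurableSpace Z] [BorelSpace Z]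
    {f : X → Y} {g : X → Z} {s : Set X} {K : ℝ≥0}
    (h : ∀ x ∈ s, ∀ y ∈ s, dist (f x) (f y) ≤ K * dist (g x) (g y)) {r : ℝ} (hr : 0 ≤ r) :
    μH[r] (f '' s) ≤ (K : ℝ≥0∞) ^ r * μH[r] (g '' s) := by
  rcases s.eq_empty_or_nonempty with rfl | ⟨x₀, hx₀⟩
  · simp
  have : Nonempty X := ⟨x₀⟩
  set φ := Function.invFunOn g s
  have hφs : ∀ x ∈ s, φ (g x) ∈ s := fun x hx => Function.invFunOn_apply_mem hx
  have hφg : ∀ x ∈ s, g (φ (g x)) = g x := fun x hx => Function.invFunOn_apply_eq hx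
  have hφf : ∀ x ∈ s, f (φ (g x)) = f x := fun x hx => by
    have := h _ (hφs x hx) _ hx
    rw [hφg x hx, dist_self, mul_zero] at this
    exact dist_le_zero.1 this
  have hlip : LipschitzOnWith K (f ∘ φ) (g '' s) := by
    refine LipschitzOnWith.of_dist_le_mul ?_
    rintro _ ⟨x, hx, rfl⟩ _ ⟨y, hy, rfl⟩
    simpa [hφf x hx, hφf y hy] using h x hx y hy
  have himage : (f ∘ φ) '' (g '' s) = f '' s := by
    rw [Set.image_image]
    exact Set.image_congr fun x hx => hφf x hx
  exact himage ▸ hlip.hausdorffMeasure_image_le hr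

/-- A comparison of two measures which holds near every point of `s` holds on `s`. -/
theorem measure_le_of_locally_le {X : Type*} [TopologicalSpace X] [SecondCountableTopology X]
    [MeasurableSpace X] [OpensMeasurableSpace X] {μ ν : Measure X} {s : Set X}
    (h : ∀ x ∈ s, ∃ U ∈ 𝓝 x, ∀ F ⊆ s ∩ U, MeasurableSet F → μ F ≤ ν F)
    {F : Set X} (hF : MeasurableSet F) (hFs : F ⊆ s) : μ F ≤ ν F := by
  choose! U hU hle using h
  obtain ⟨t, hts, htc, hcov⟩ := TopologicalSpace.countable_cover_nhdsWithin
    (f := fun x => interior (U x)) (s := s)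
    fun x hx => mem_nhdsWithin_of_mem_nhds (interior_mem_nhds.2 (hU x hx))
  rcases t.eq_empty_or_nonempty with rfl | hne
  · simp [Set.subset_empty_iff.1 (hFs.trans (by simpa using hcov))]
  obtain ⟨e, rfl⟩ := htc.exists_eq_range hne
  rw [Set.biUnion_range] at hcov
  set D := disjointed fun n => interior (U (e n))
  have hD : ∀ n, MeasurableSet (D n) :=
    MeasurableSet.disjointed fun n => isOpen_interior.measurableSet
  have hFD : F = ⋃ n, F ∩ D n := by
    rw [← Set.inter_iUnion, iUnion_disjointed, Set.inter_eq_left.2 (hFs.trans hcov)]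
  have hdisj : Pairwise (Function.onFun Disjoint fun n => F ∩ D n) := fun i j hij =>
    (disjoint_disjointed _ hij).mono Set.inter_subset_right Set.inter_subset_right
  rw [hFD, measure_iUnion hdisj fun n => hF.inter (hD n),
    measure_iUnion hdisj fun n => hF.inter (hD n)]
  refine ENNReal.tsum_le_tsum fun n => hle (e n) (hts ⟨n, rfl⟩) _ ?_ (hF.inter (hD n))
  exact Set.inter_subset_inter hFs ((disjointed_subset _ _).trans interior_subset)

section InnerProductSpace

variable {E : Type*} [NormedAddCommGroup E] [InnerProductSpace ℝ E]

/-- A linear map `L` scales the volume of the hyperplane orthogonal to a unit vector `s` by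
`|det L| * ‖g‖`, where `g` is the image of `s` under the inverse transpose of `L`. -/
theorem normDet_domRestrict_orthogonal_singleton [FiniteDimensional ℝ E] (L : E →ₗ[ℝ] E)
    {s g : E} (hs : ‖s‖ = 1) (hg : ∀ x, inner ℝ (L x) g = inner ℝ x s) :
    (L.domRestrict (ℝ ∙ s)ᗮ).normDet = |L.det| * ‖g‖ := by
  have hg0 : g ≠ 0 := by
    rintro rfl
    have := hg s
    simp [hs] at this
  have hgn : ‖g‖ ≠ 0 := norm_ne_zero_iff.2 hg0
  set w : E := ‖g‖⁻¹ • g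
  have hw : ‖w‖ = ‖s‖ := by simp [w, norm_smul, hgn, hs]
  set Q : E ≃ₗᵢ[ℝ] E := (ℝ ∙ (w - s))ᗮ.reflection
  have hQw : Q w = s := Submodule.reflection_sub hw
  set M : E →ₗ[ℝ] E := Q.toLinearEquiv.toLinearMap ∘ₗ L
  have hM : ∀ x, inner ℝ s (M x) = ‖g‖⁻¹ * inner ℝ s x := fun x => by
    rw [← hQw]
    change inner ℝ (Q w) (Q (L x)) = _
    rw [Q.inner_map_map, hQw, real_inner_comm, inner_smul_right, hg, real_inner_comm]
  set T := (ℝ ∙ s)ᗮ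
  have hT : T ≤ T.comap M := fun x hx => by
    rw [Submodule.mem_comap, Submodule.mem_orthogonal_singleton_iff_inner_right, hM,
      Submodule.mem_orthogonal_singleton_iff_inner_right.1 hx, mul_zero]
  have hT' : ∀ x ∈ T, M x ∈ T := hT
  have hquot : T.mapQ T M hT = ‖g‖⁻¹ • LinearMap.id := by
    refine LinearMap.ext fun x => ?_
    induction x using Submodule.Quotient.induction_on with
    | _ x =>
      rw [Submodule.mapQ_apply, LinearMap.smul_apply, LinearMap.id_apply,
        ← Submodule.Quotient.mk_smul, Submodule.Quotient.eq,
        Submodule.mem_orthogonal_singleton_iff_inner_right, inner_sub_right, hM,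
        inner_smul_right, sub_self]
  have hfin : finrank ℝ (E ⧸ T) = 1 := by
    have h1 := T.finrank_quotient_add_finrank
    have h2 := (ℝ ∙ s).finrank_add_finrank_orthogonal
    rw [finrank_span_singleton (norm_ne_zero_iff.1 (by simp [hs]))] at h2
    change 1 + finrank ℝ T = _ at h2
    omega
  have hdet : M.det = (M.restrict hT').det * ‖g‖⁻¹ := by
    rw [M.det_eq_det_mul_det T hT, hquot, LinearMap.det_smul, hfin]
    simp
  have hdetM : |M.det| = |L.det| := by
    rw [LinearMap.det_comp, abs_mul, ← LinearMap.normDet_eq_abs_det (Q.toLinearEquiv.toLinearMap)]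
    rw [show Q.toLinearEquiv.toLinearMap.normDet = 1 from Q.toLinearIsometry.normDet_eq_one,
      one_mul]
  have hiso : (Q.toLinearEquiv.toLinearMap ∘ₗ L.domRestrict T).normDet
      = (L.domRestrict T).normDet := by
    rw [LinearMap.normDet_comp]
    rw [show (Q.toLinearEquiv.toLinearMap.domRestrict (L.domRestrict T).range).normDet = 1 from
      (Q.toLinearIsometry.comp (L.domRestrict T).range.subtypeₗᵢ).normDet_eq_one, one_mul]
  have hres : (M.restrict hT').normDet = (L.domRestrict T).normDet := by
    rw [← hiso]
    exact LinearMap.normDet_codRestrict _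
  rw [← hres, LinearMap.normDet_eq_abs_det, ← hdetM, hdet, abs_mul, abs_inv, abs_norm,
    inv_mul_cancel_right₀ hgn]

/-- Near a point `s` of the unit sphere, chords are almost orthogonal to `s`. -/
theorem abs_inner_sub_le_of_norm_eq {s x y : E} {δ : ℝ} (hxy : ‖x‖ = ‖y‖)
    (hx : ‖x - s‖ ≤ δ) (hy : ‖y - s‖ ≤ δ) : |inner ℝ s (x - y)| ≤ δ * ‖x - y‖ := by
  have h0 : inner ℝ (x + y) (x - y) = 0 := (real_inner_add_sub_eq_zero_iff x y).2 hxy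
  have hmid : inner ℝ s (x - y) = inner ℝ (-((1 / 2 : ℝ) • ((x - s) + (y - s)))) (x - y) := by
    have : -((1 / 2 : ℝ) • ((x - s) + (y - s))) = s - (1 / 2 : ℝ) • (x + y) := by module
    rw [this, inner_sub_left, inner_smul_left, h0, mul_zero, sub_zero]
  rw [hmid]
  refine (abs_real_inner_le_norm _ _).trans ?_
  gcongr
  rw [norm_neg, norm_smul]
  have := norm_add_le (x - s) (y - s)
  norm_num
  linarith

/-- Near a point `s` of the unit sphere, both the projection onto `sᗮ` and an invertible linear map
are almost unaffected by replacing a chord by its projection onto `sᗮ`. -/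
theorem exists_nhds_sphere_norm_comparison (L : E ≃L[ℝ] E) {s : E} (hs : ‖s‖ = 1) {K : ℝ}
    (hK : 1 < K) :
    ∃ U ∈ 𝓝 s, ∀ x ∈ Metric.sphere (0 : E) 1 ∩ U, ∀ y ∈ Metric.sphere (0 : E) 1 ∩ U,
      ‖x - y‖ ≤ K * ‖(ℝ ∙ s)ᗮ.starProjection (x - y)‖ ∧
      ‖L (x - y)‖ ≤ K * ‖L ((ℝ ∙ s)ᗮ.starProjection (x - y))‖ ∧
      ‖L ((ℝ ∙ s)ᗮ.starProjection (x - y))‖ ≤ K * ‖L (x - y)‖ := by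
  set M := ‖(L : E →L[ℝ] E)‖
  set N := ‖(L.symm : E →L[ℝ] E)‖
  have hMN : 0 ≤ M * N := by positivity
  set ε := 1 - K⁻¹
  have hKi : K⁻¹ < 1 := inv_lt_one_of_one_lt₀ hK
  have hKK : K * K⁻¹ = 1 := mul_inv_cancel₀ (by positivity)
  have hε : 0 < ε := by simp only [ε]; linarith
  have hKε : K * (1 - ε) = 1 := by simp [ε, hKK]
  have hKε' : 1 + ε ≤ K := by
    have : 0 < K⁻¹ := by positivity
    simp only [ε]
    nlinarith
  set δ := ε / (1 + M * N)
  have hδ : 0 < δ := by positivity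
  have hδε : δ * (1 + M * N) = ε := div_mul_cancel₀ _ (by positivity)
  refine ⟨Metric.closedBall s δ, Metric.closedBall_mem_nhds s hδ, ?_⟩
  rintro x ⟨hx, hxU⟩ y ⟨hy, hyU⟩
  rw [mem_sphere_zero_iff_norm] at hx hy
  rw [mem_closedBall_iff_norm] at hxU hyU
  have hin := abs_inner_sub_le_of_norm_eq (hx.trans hy.symm) hxU hyU
  set v := x - y
  set p := (ℝ ∙ s)ᗮ.starProjection v
  have hvp : ‖v - p‖ ≤ δ * ‖v‖ := by
    have : v - p = (inner ℝ s v : ℝ) • s := by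
      rw [← Submodule.starProjection_unit_singleton ℝ hs]
      simp [p, Submodule.starProjection_orthogonal_val]
    rw [this, norm_smul, hs, mul_one]
    exact hin
  have hLvp : ‖L v - L p‖ ≤ ε * ‖L v‖ := by
    have h1 : ‖L v - L p‖ ≤ M * ‖v - p‖ := by
      rw [← map_sub]
      exact (L : E →L[ℝ] E).le_opNorm _
    have h2 : ‖v‖ ≤ N * ‖L v‖ := by
      simpa using (L.symm : E →L[ℝ] E).le_opNorm (L v)
    calc ‖L v - L p‖ ≤ M * (δ * (N * ‖L v‖)) := by
          refine h1.trans ?_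
          gcongr
          exact hvp.trans (by gcongr)
      _ = (δ * (M * N)) * ‖L v‖ := by ring
      _ ≤ ε * ‖L v‖ := by
          gcongr
          linarith
  have hδ' : δ ≤ ε := by nlinarith
  refine ⟨?_, ?_, ?_⟩
  · have h1 := norm_sub_norm_le v p
    have h2 : (1 - ε) * ‖v‖ ≤ ‖p‖ := by nlinarith [norm_nonneg v]
    calc ‖v‖ = K * ((1 - ε) * ‖v‖) := by rw [← mul_assoc, hKε, one_mul]
      _ ≤ K * ‖p‖ := by gcongr
  · have h1 := norm_sub_norm_le (L v) (L p)
    have h2 : (1 - ε) * ‖L v‖ ≤ ‖L p‖ := by linarith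
    calc ‖L v‖ = K * ((1 - ε) * ‖L v‖) := by rw [← mul_assoc, hKε, one_mul]
      _ ≤ K * ‖L p‖ := by gcongr
  · have h1 := norm_sub_norm_le (L p) (L v)
    rw [norm_sub_rev] at h1
    calc ‖L p‖ ≤ (1 + ε) * ‖L v‖ := by linarith
      _ ≤ K * ‖L v‖ := by gcongr

variable [FiniteDimensional ℝ E] [MeasurableSpace E] [BorelSpace E]

/-- Near a point `s` of the unit sphere, a linear map `L` scales the surface measure almost by the
factor by which it scales the measure of the tangent space at `s`. -/
theorem exists_nhds_hausdorffMeasure_image_sphere_comparison (L : E ≃L[ℝ] E) {s : E}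
    (hs : ‖s‖ = 1) {n : ℕ} (hn : finrank ℝ (ℝ ∙ s)ᗮ = n) {K : ℝ≥0} (hK : 1 < K) :
    ∃ U ∈ 𝓝 s, ∀ F ⊆ Metric.sphere (0 : E) 1 ∩ U,
      μH[n] (L '' F) ≤ (K : ℝ≥0∞) ^ n *
        (ENNReal.ofReal ((L : E →ₗ[ℝ] E).domRestrict (ℝ ∙ s)ᗮ).normDet * μH[n] F) ∧
      ENNReal.ofReal ((L : E →ₗ[ℝ] E).domRestrict (ℝ ∙ s)ᗮ).normDet * μH[n] F ≤
        (K : ℝ≥0∞) ^ (2 * n) * μH[n] (L '' F) := by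
  obtain ⟨U, hU, hcomp⟩ := exists_nhds_sphere_norm_comparison L hs (K := K) (by exact_mod_cast hK)
  refine ⟨U, hU, fun F hF => ?_⟩
  set T := (ℝ ∙ s)ᗮ
  set J := ENNReal.ofReal ((L : E →ₗ[ℝ] E).domRestrict T).normDet
  set P : E →L[ℝ] T := T.orthogonalProjectionOnto
  have hn0 : (0 : ℝ) ≤ n := n.cast_nonneg
  have hlin : μH[n] ((fun x => L (P x : E)) '' F) = J * μH[n] (P '' F) := by
    have := ((L : E →ₗ[ℝ] E).domRestrict T).hausdorffMeasure_image (P '' F)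
    rw [hn, Set.image_image] at this
    exact this
  have h1 : μH[n] (L '' F) ≤ (K : ℝ≥0∞) ^ n * μH[n] ((fun x => L (P x : E)) '' F) := by
    rw [← ENNReal.rpow_natCast]
    refine hausdorffMeasure_image_le_of_dist_le (fun x hx y hy => ?_) hn0
    rw [dist_eq_norm, dist_eq_norm, ← map_sub, ← map_sub, ← Submodule.coe_sub, ← map_sub]
    exact (hcomp x (hF hx) y (hF hy)).2.1
  have h2 : μH[n] ((fun x => L (P x : E)) '' F) ≤ (K : ℝ≥0∞) ^ n * μH[n] (L '' F) := by
    rw [← ENNReal.rpow_natCast]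
    refine hausdorffMeasure_image_le_of_dist_le (fun x hx y hy => ?_) hn0
    rw [dist_eq_norm, dist_eq_norm, ← map_sub, ← map_sub, ← Submodule.coe_sub, ← map_sub]
    exact (hcomp x (hF hx) y (hF hy)).2.2
  have h3 : μH[n] F ≤ (K : ℝ≥0∞) ^ n * μH[n] (P '' F) := by
    rw [← ENNReal.rpow_natCast]
    conv_lhs => rw [← Set.image_id F]
    refine hausdorffMeasure_image_le_of_dist_le (fun x hx y hy => ?_) hn0
    rw [dist_eq_norm, dist_eq_norm, ← map_sub]
    exact (hcomp x (hF hx) y (hF hy)).1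
  have h4 : μH[n] (P '' F) ≤ μH[n] F :=
    hausdorffMeasure_orthogonalProjectionOnto_le T _ F hn0
  constructor
  · refine h1.trans ?_
    rw [hlin]
    gcongr
  · calc J * μH[n] F ≤ J * ((K : ℝ≥0∞) ^ n * μH[n] (P '' F)) := by gcongr
      _ = (K : ℝ≥0∞) ^ n * (J * μH[n] (P '' F)) := by ring
      _ ≤ (K : ℝ≥0∞) ^ n * ((K : ℝ≥0∞) ^ n * μH[n] (L '' F)) := by
          rw [← hlin]
          gcongr
      _ = (K : ℝ≥0∞) ^ (2 * n) * μH[n] (L '' F) := by ring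

theorem ENNReal.le_of_forall_one_lt_le_pow_mul {a b : ℝ≥0∞} (m : ℕ)
    (h : ∀ K : ℝ≥0, 1 < K → a ≤ (K : ℝ≥0∞) ^ m * b) : a ≤ b := by
  have hlim : Tendsto (fun K : ℝ≥0 => (K : ℝ≥0∞) ^ m * b) (𝓝[>] 1) (𝓝 b) := by
    have h1 : Tendsto (fun K : ℝ≥0 => (K : ℝ≥0∞) ^ m) (𝓝[>] 1) (𝓝 1) := by
      have : Continuous fun K : ℝ≥0 => (K : ℝ≥0∞) ^ m := by fun_prop
      simpa using (this.tendsto 1).mono_left nhdsWithin_le_nhds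
    simpa using ENNReal.Tendsto.mul_const h1 (Or.inl one_ne_zero)
  exact ge_of_tendsto hlim (eventually_mem_nhdsWithin.mono h)

/-- **Area formula for a linear map on the unit sphere.** Here `G` is the inverse transpose
of `L`. -/
theorem lintegral_sphere_eq_hausdorffMeasure_image {n : ℕ} (hn : finrank ℝ E = n + 1)
    (L G : E ≃L[ℝ] E) (hG : ∀ s x, inner ℝ (L x) (G s) = inner ℝ x s)
    {F : Set E} (hF : MeasurableSet F) (hFs : F ⊆ Metric.sphere 0 1) :
    ∫⁻ s in F, ENNReal.ofReal (|(L : E →ₗ[ℝ] E).det| * ‖G s‖) ∂μH[n] = μH[n] (L '' F) := by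
  set J : E → ℝ≥0 := fun s => Real.toNNReal (|(L : E →ₗ[ℝ] E).det| * ‖G s‖)
  have hJc : Continuous J := by fun_prop
  set ρ : Measure E := μH[n].withDensity fun s => J s
  set ν : Measure E := μH[n].map L.symm
  have hρ : ∀ {F}, MeasurableSet F → ρ F = ∫⁻ s in F, J s ∂μH[n] := fun hF =>
    withDensity_apply _ hF
  have hν : ∀ F, ν F = μH[n] (L '' F) := fun F => by
    rw [L.image_eq_preimage_symm]
    exact L.symm.toHomeomorph.toMeasurableEquiv.map_apply F
  change ∫⁻ s in F, J s ∂μH[n] = _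
  rw [← hρ hF, ← hν]
  have hlocal : ∀ K : ℝ≥0, 1 < K → ∀ s ∈ Metric.sphere (0 : E) 1, ∃ U ∈ 𝓝 s,
      ∀ F ⊆ Metric.sphere 0 1 ∩ U, MeasurableSet F →
        ν F ≤ (K : ℝ≥0∞) ^ (n + 1) * ρ F ∧ ρ F ≤ (K : ℝ≥0∞) ^ (2 * n + 1) * ν F := by
    intro K hK s hs
    rw [mem_sphere_zero_iff_norm] at hs
    have hs0 : s ≠ 0 := norm_ne_zero_iff.1 (by simp [hs])
    have hnT : finrank ℝ (ℝ ∙ s)ᗮ = n := by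
      have : Fact (finrank ℝ E = n + 1) := ⟨hn⟩
      exact Submodule.finrank_orthogonal_span_singleton hs0
    obtain ⟨U, hU, hcomp⟩ := exists_nhds_hausdorffMeasure_image_sphere_comparison L hs hnT hK
    have hJs : ENNReal.ofReal ((L : E →ₗ[ℝ] E).domRestrict (ℝ ∙ s)ᗮ).normDet = J s := by
      rw [normDet_domRestrict_orthogonal_singleton (L : E →ₗ[ℝ] E) hs (hG s)]
      rfl
    rw [hJs] at hcomp
    have hJpos : 0 < J s := by
      have hdet : (L : E →ₗ[ℝ] E).det ≠ 0 := L.toLinearEquiv.isUnit_det'.ne_zero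
      have hGs : G s ≠ 0 := by simpa using hs0
      exact Real.toNNReal_pos.2 (by positivity)
    have hV1 : ∀ᶠ t in 𝓝 s, J t < K * J s :=
      hJc.continuousAt.eventually_lt continuousAt_const (lt_mul_of_one_lt_left hJpos hK)
    have hV2 : ∀ᶠ t in 𝓝 s, J s < K * J t :=
      ContinuousAt.eventually_lt continuousAt_const (by fun_prop)
        (lt_mul_of_one_lt_left hJpos hK)
    refine ⟨_, inter_mem hU (hV1.and hV2), fun F hF hFm => ?_⟩
    obtain ⟨h1, h2⟩ := hcomp F fun x hx => ⟨(hF hx).1, (hF hx).2.1⟩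
    rw [← hν] at h1 h2
    have h3 : ρ F ≤ K * (J s * μH[n] F) := by
      rw [hρ hFm, ← mul_assoc, ← setLIntegral_const]
      exact setLIntegral_mono measurable_const fun t ht => by
        exact_mod_cast (hF ht).2.2.1.le
    have h4 : J s * μH[n] F ≤ K * ρ F := by
      rw [hρ hFm, ← setLIntegral_const, ← lintegral_const_mul _ (by fun_prop)]
      exact setLIntegral_mono (by fun_prop) fun t ht => by
        exact_mod_cast (hF ht).2.2.2.le
    constructor
    · calc ν F ≤ (K : ℝ≥0∞) ^ n * (K * ρ F) := h1.trans (by gcongr)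
        _ = _ := by ring
    · calc ρ F ≤ K * ((K : ℝ≥0∞) ^ (2 * n) * ν F) := h3.trans (by gcongr)
        _ = _ := by ring
  apply le_antisymm
  · refine ENNReal.le_of_forall_one_lt_le_pow_mul (2 * n + 1) fun K hK => ?_
    refine measure_le_of_locally_le (ν := (K : ℝ≥0∞) ^ (2 * n + 1) • ν) (fun s hs => ?_) hF hFs
    obtain ⟨U, hU, h⟩ := hlocal K hK s hs
    exact ⟨U, hU, fun F hF hFm => (h F hF hFm).2⟩
  · refine ENNReal.le_of_forall_one_lt_le_pow_mul (n + 1) fun K hK => ?_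
    refine measure_le_of_locally_le (ν := (K : ℝ≥0∞) ^ (n + 1) • ρ) (fun s hs => ?_) hF hFs
    obtain ⟨U, hU, h⟩ := hlocal K hK s hs
    exact ⟨U, hU, fun F hF hFm => (h F hF hFm).1⟩

end InnerProductSpace

/-- The action of an invertible matrix on Euclidean space. -/
noncomputable def matrixContinuousLinearEquiv {ι : Type*} [Fintype ι] [DecidableEq ι]
    (M : Matrix ι ι ℝ) (hM : IsUnit M.det) : EuclideanSpace ℝ ι ≃L[ℝ] EuclideanSpace ℝ ι :=
  ((Matrix.toLpLin 2 2 M).equivOfDetNeZero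
    (by rw [LinearMap.det_toLpLin]; exact hM.ne_zero)).toContinuousLinearEquiv

/-- Rejection-sampling identity: for `Lᵀ A L = I` with `A` symmetric
positive definite, and any Borel `E` contained in the ellipsoid `C = {v : vᵀ A v = 1}`,
`∫_{s ∈ S^{d−1} : Ls ∈ E} √((Ls)ᵀ A² (Ls)) dσ_{S^{d−1}}(s) = σ_C(E) / |det L|`;
i.e. reweighting the uniform proposal on the sphere by `√(vᵀ A² v)`, `v = Ls`, produces
(a constant multiple of) the Hausdorff measure on `C`, hence the uniform distribution. -/
theorem sphere_rejection_sampling_uniform_on_ellipsoid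
    (d : ℕ) (A L : Matrix (Fin d) (Fin d) ℝ)
    (hA : A.PosDef) (hL : IsUnit L.det) (hLA : Lᵀ * A * L = 1) :
    ∀ E : Set (EuclideanSpace ℝ (Fin d)), MeasurableSet E →
      E ⊆ {v : EuclideanSpace ℝ (Fin d) | (fun i => v i) ⬝ᵥ A.mulVec (fun i => v i) = 1} →
      (∫⁻ s in
          (fun s : EuclideanSpace ℝ (Fin d) => toE (L.mulVec fun i => s i)) ⁻¹' E,
          ENNReal.ofReal
            (Real.sqrt ((L.mulVec fun i => s i) ⬝ᵥ (A * A).mulVec (L.mulVec fun i => s i)))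
        ∂((μH[(d : ℝ) - 1]).restrict
            (Metric.sphere (0 : EuclideanSpace ℝ (Fin d)) 1))) =
      ENNReal.ofReal (1 / |L.det|) *
        ((μH[(d : ℝ) - 1]).restrict
            {v : EuclideanSpace ℝ (Fin d) |
              (fun i => v i) ⬝ᵥ A.mulVec (fun i => v i) = 1}) E := by
  intro E hE hEC
  cases d with
  | zero =>
    have hE0 : E = ∅ := Set.eq_empty_of_forall_notMem fun v hv => by simpa using hEC hv
    simp [hE0]
  | succ n =>
    have hA1 : Aᵀ = A := by simpa using hA.isHermitian.eq
    have hAdet : IsUnit A.det := hA.det_pos.ne'.isUnit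
    set L' : EuclideanSpace ℝ (Fin (n + 1)) ≃L[ℝ] EuclideanSpace ℝ (Fin (n + 1)) :=
      matrixContinuousLinearEquiv L hL
    set G : EuclideanSpace ℝ (Fin (n + 1)) ≃L[ℝ] EuclideanSpace ℝ (Fin (n + 1)) :=
      matrixContinuousLinearEquiv (A * L) (by rw [det_mul]; exact hAdet.mul hL)
    have hform : ∀ u v : Fin (n + 1) → ℝ, (L *ᵥ u) ⬝ᵥ (A *ᵥ (L *ᵥ v)) = u ⬝ᵥ v := fun u v => by
      rw [← vecMul_transpose, ← dotProduct_mulVec, mulVec_mulVec, mulVec_mulVec, hLA, one_mulVec]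
    have hG : ∀ s x, inner ℝ (L' x) (G s) = inner ℝ x s := fun s x => by
      rw [real_inner_comm, real_inner_comm s x]
      simp only [EuclideanSpace.inner_eq_star_dotProduct, star_trivial]
      change (L *ᵥ x.ofLp) ⬝ᵥ ((A * L) *ᵥ s.ofLp) = _
      rw [← mulVec_mulVec, hform]
    have hnorm : ∀ s, Real.sqrt ((L *ᵥ s.ofLp) ⬝ᵥ (A * A) *ᵥ (L *ᵥ s.ofLp)) = ‖G s‖ :=
      fun s => by
      rw [norm_eq_sqrt_real_inner, EuclideanSpace.inner_eq_star_dotProduct, star_trivial]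
      change _ = Real.sqrt (((A * L) *ᵥ s.ofLp) ⬝ᵥ ((A * L) *ᵥ s.ofLp))
      rw [← mulVec_mulVec, ← mulVec_mulVec, dotProduct_mulVec, ← mulVec_transpose, hA1]
    have hsphere : L' ⁻¹' E ⊆ Metric.sphere 0 1 := fun s hs => by
      have h1 : (L *ᵥ s.ofLp) ⬝ᵥ (A *ᵥ (L *ᵥ s.ofLp)) = 1 := hEC hs
      rw [hform] at h1
      rw [mem_sphere_zero_iff_norm, norm_eq_sqrt_real_inner,
        EuclideanSpace.inner_eq_star_dotProduct, star_trivial, h1, Real.sqrt_one]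
    have hmeas : MeasurableSet (L' ⁻¹' E) := L'.continuous.measurable hE
    have hdim : ((n + 1 : ℕ) : ℝ) - 1 = n := by push_cast; ring
    have hdet : 0 < |L.det| := abs_pos.2 hL.ne_zero
    have harea := lintegral_sphere_eq_hausdorffMeasure_image (n := n) (by simp) L' G hG hmeas
      hsphere
    rw [Set.image_preimage_eq _ L'.surjective] at harea
    rw [hdim, Measure.restrict_apply hE, Set.inter_eq_left.2 hEC, ← harea]
    change ∫⁻ s in L' ⁻¹' E, _ ∂_ = _
    rw [Measure.restrict_restrict hmeas, Set.inter_eq_left.2 hsphere,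
      ← lintegral_const_mul _ (by fun_prop)]
    refine lintegral_congr fun s => ?_
    rw [← ENNReal.ofReal_mul (by positivity), hnorm,
      show (L' : EuclideanSpace ℝ (Fin (n + 1)) →ₗ[ℝ] EuclideanSpace ℝ (Fin (n + 1))).det = L.det
        from LinearMap.det_toLpLin 2 L, ← mul_assoc, one_div_mul_cancel hdet.ne', one_mul]
end

section
/- Let d ≥ 1, μ > 0, p ∈ ℝ^d, and let f : ℝ^d → ℝ be four times continuously differentiable with the operator norm of the fourth derivative satisfying ‖D⁴f(q)‖ ≤ M₄ for all q in the closed ball of radius μ around p. For v ~ Unif(S^{d−1}) define ĝ(p; v) := ((f(p + μv) − f(p − μv))/(2μ))·v. Then ‖E_v[ĝ(p; v)] − (1/d)·∇f(p)‖₂ ≤ (μ²/(2d(d+2)))·‖∇(Δf)(p)‖₂ + M₄·μ³/24, where Δf = Σ_i ∂²f/∂x_i² is the Laplacian of f and ∇(Δf)(p) its gradient at p. -/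
open MeasureTheory

/-- The uniform probability measure on the unit sphere `S^{d-1} ⊆ ℝ^d`, i.e. the normalized
`(d-1)`-dimensional Hausdorff measure restricted to the sphere. -/
noncomputable def sphereUniform (d : ℕ) : Measure (EuclideanSpace ℝ (Fin d)) :=
  (μH[(d : ℝ) - 1] (Metric.sphere (0 : EuclideanSpace ℝ (Fin d)) 1))⁻¹ •
    (μH[(d : ℝ) - 1]).restrict (Metric.sphere (0 : EuclideanSpace ℝ (Fin d)) 1)

/-- The Laplacian `Δf = Σᵢ ∂²f/∂xᵢ²` of `f : ℝ^d → ℝ`. -/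
noncomputable def laplacian {d : ℕ} (f : EuclideanSpace ℝ (Fin d) → ℝ)
    (x : EuclideanSpace ℝ (Fin d)) : ℝ :=
  ∑ i : Fin d,
    iteratedFDeriv ℝ 2 f x ![EuclideanSpace.single i (1 : ℝ), EuclideanSpace.single i 1]

section HausdorffMeasure

open Metric Set
open scoped ENNReal NNReal

theorem hausdorffMeasure_sphere_pos (n : ℕ) :
    0 < μH[(n : ℝ)] (sphere (0 : EuclideanSpace ℝ (Fin (n + 1))) 1) := by
  set P : EuclideanSpace ℝ (Fin (n + 1)) → (Fin n → ℝ) := fun v i => v i.succ with hP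
  have hPL : LipschitzWith 1 P := by
    refine LipschitzWith.of_dist_le_mul fun x y => ?_
    rw [NNReal.coe_one, one_mul, dist_pi_le_iff dist_nonneg]
    intro i
    rw [dist_eq_norm x y, Real.dist_eq]
    simpa using PiLp.norm_apply_le (x - y) i.succ
  have hopen : IsOpen {y : Fin n → ℝ | ∑ i, y i ^ 2 < 1} :=
    isOpen_lt (by fun_prop) continuous_const
  have hvol : 0 < (volume : Measure (Fin n → ℝ)) {y | ∑ i, y i ^ 2 < 1} :=
    hopen.measure_pos _ ⟨0, by simp⟩
  have hsub : {y : Fin n → ℝ | ∑ i, y i ^ 2 < 1} ⊆ P '' sphere 0 1 := by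
    intro y hy
    have hy' : 0 ≤ 1 - ∑ i, y i ^ 2 := sub_nonneg.2 (le_of_lt hy)
    refine ⟨WithLp.toLp 2 (Fin.cons (√(1 - ∑ i, y i ^ 2)) y), ?_, ?_⟩
    · simp [EuclideanSpace.norm_eq, Fin.sum_univ_succ, Real.sq_sqrt hy']
    · ext i
      simp [hP]
  have h := hPL.hausdorffMeasure_image_le (Nat.cast_nonneg n) (sphere 0 1)
  rw [ENNReal.coe_one, ENNReal.one_rpow, one_mul] at h
  have hpi : (μH[(n : ℝ)] : Measure (Fin n → ℝ)) = volume := by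
    simpa using hausdorffMeasure_pi_real (ι := Fin n)
  rw [hpi] at h
  exact hvol.trans_le ((measure_mono hsub).trans h)

theorem hausdorffMeasure_sphere_lt_top (n : ℕ) :
    μH[(n : ℝ)] (sphere (0 : EuclideanSpace ℝ (Fin (n + 1))) 1) < ∞ := by
  set face : Fin (n + 1) → ℝ → (Fin n → ℝ) → EuclideanSpace ℝ (Fin (n + 1)) :=
    fun i s y => WithLp.toLp 2 (i.insertNth s y) with hface
  set g : Fin (n + 1) → ℝ → (Fin n → ℝ) → EuclideanSpace ℝ (Fin (n + 1)) :=
    fun i s y => ‖face i s y‖⁻¹ • face i s y with hg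
  have hfin : ∀ i, ∀ s : ℝ, s ≠ 0 → μH[(n : ℝ)] (g i s '' Icc (-1) 1) < ∞ := by
    intro i s hs
    have hface0 : ∀ y, face i s y ≠ 0 := fun y h => hs <| by
      simpa [hface] using congrArg (fun v : EuclideanSpace ℝ (Fin (n + 1)) => v i) h
    have hfaceC : ContDiff ℝ 1 (face i s) := by
      rw [contDiff_euclidean]
      intro j
      rcases Fin.eq_self_or_eq_succAbove i j with rfl | ⟨k, rfl⟩
      · simpa [hface] using contDiff_const
      · simpa [hface] using contDiff_apply ℝ ℝ k
    have hgC : ContDiff ℝ 1 (g i s) :=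
      ((hfaceC.norm ℝ hface0).inv fun y => norm_ne_zero_iff.2 (hface0 y)).smul hfaceC
    obtain ⟨K, hK⟩ := hgC.contDiffOn.exists_lipschitzOnWith one_ne_zero
      (convex_Icc (-1 : Fin n → ℝ) 1) isCompact_Icc
    refine (hK.hausdorffMeasure_image_le (Nat.cast_nonneg n)).trans_lt ?_
    have hpi : (μH[(n : ℝ)] : Measure (Fin n → ℝ)) = volume := by
      simpa using hausdorffMeasure_pi_real (ι := Fin n)
    rw [hpi, ENNReal.rpow_natCast]
    exact ENNReal.mul_lt_top (ENNReal.pow_lt_top ENNReal.coe_lt_top)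
      isCompact_Icc.measure_lt_top
  have hcover : sphere (0 : EuclideanSpace ℝ (Fin (n + 1))) 1 ⊆
      ⋃ i, (g i 1 '' Icc (-1) 1 ∪ g i (-1) '' Icc (-1) 1) := by
    intro v hv
    rw [mem_sphere_zero_iff_norm] at hv
    obtain ⟨i, hi⟩ := Finite.exists_max fun i => |v i|
    have hpos : 0 < |v i| := by
      refine (abs_nonneg _).lt_of_ne' fun h0 => ?_
      have : v = 0 := by
        ext j
        simpa using (hi j).trans h0.le
      simp [this] at hv
    set y : Fin n → ℝ := fun k => |v i|⁻¹ * v (i.succAbove k)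
    have hy : y ∈ Icc (-1 : Fin n → ℝ) 1 := by
      have : ∀ k, |y k| ≤ 1 := fun k => by
        rw [abs_mul, abs_inv, abs_abs, inv_mul_le_one₀ hpos]
        exact hi _
      exact ⟨fun k => (abs_le.1 (this k)).1, fun k => (abs_le.1 (this k)).2⟩
    have key : ∀ s : ℝ, s = |v i|⁻¹ * v i → g i s y = v := by
      intro s hs
      have hF : face i s y = |v i|⁻¹ • v := by
        ext j
        rcases Fin.eq_self_or_eq_succAbove i j with rfl | ⟨k, rfl⟩ <;> simp [hface, hs, y]
      simp only [hg]
      rw [hF, norm_smul, hv, smul_smul]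
      simp [hpos.ne']
    refine mem_iUnion.2 ⟨i, ?_⟩
    rcases abs_cases (v i) with ⟨h, -⟩ | ⟨h, -⟩
    · refine Or.inl ⟨y, hy, key 1 ?_⟩
      rw [h] at hpos ⊢
      exact (inv_mul_cancel₀ hpos.ne').symm
    · refine Or.inr ⟨y, hy, key (-1) ?_⟩
      rw [h] at hpos ⊢
      rw [inv_neg, neg_mul, inv_mul_cancel₀ (neg_pos.1 hpos).ne]
  refine (measure_mono hcover).trans_lt ((measure_iUnion_fintype_le _ _).trans_lt ?_)
  exact ENNReal.sum_lt_top.2 fun i _ => (measure_union_le _ _).trans_lt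
    (ENNReal.add_lt_top.2 ⟨hfin i 1 one_ne_zero, hfin i (-1) (by norm_num)⟩)

end HausdorffMeasure

section Moments

open scoped RealInnerProductSpace

variable {d : ℕ}

local notation "E" => EuclideanSpace ℝ (Fin d)

theorem isProbabilityMeasure_sphereUniform (hd : 1 ≤ d) :
    IsProbabilityMeasure (sphereUniform d) := by
  obtain ⟨n, rfl⟩ := Nat.exists_eq_add_of_le' hd
  constructor
  have h : ((n + 1 : ℕ) : ℝ) - 1 = n := by push_cast; ring
  rw [sphereUniform, h, Measure.smul_apply, Measure.restrict_apply_univ, smul_eq_mul]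
  exact ENNReal.inv_mul_cancel (hausdorffMeasure_sphere_pos n).ne'
    (hausdorffMeasure_sphere_lt_top n).ne

theorem ae_sphereUniform_norm_eq_one (d : ℕ) : ∀ᵐ v ∂sphereUniform d, ‖v‖ = 1 := by
  refine Measure.ae_smul_measure ?_ _
  filter_upwards [ae_restrict_mem Metric.isClosed_sphere.measurableSet] with v hv
  simpa using hv

theorem measurePreserving_sphereUniform (e : E ≃ₗᵢ[ℝ] E) :
    MeasurePreserving e (sphereUniform d) (sphereUniform d) := by
  have h := ((e.toIsometryEquiv.measurePreserving_hausdorffMeasure ((d : ℝ) - 1)).restrict_preimage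
    (s := Metric.sphere 0 1) Metric.isClosed_sphere.measurableSet)
  have hpre : e.toIsometryEquiv ⁻¹' Metric.sphere (0 : E) 1 = Metric.sphere 0 1 := by
    ext v
    simp
  rw [hpre] at h
  exact h.smul_measure _

theorem Continuous.integrable_sphereUniform {F : Type*} [NormedAddCommGroup F] (hd : 1 ≤ d)
    {g : E → F} (hg : Continuous g) :
    Integrable g (sphereUniform d) := by
  have := isProbabilityMeasure_sphereUniform hd
  have h : (sphereUniform d).restrict (Metric.sphere 0 1) = sphereUniform d :=
    Measure.restrict_eq_self_of_ae_mem <| by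
      filter_upwards [ae_sphereUniform_norm_eq_one d] with v hv
      simpa using hv
  rw [← h]
  exact hg.continuousOn.integrableOn_compact (isCompact_sphere 0 1)

theorem exists_integral_inner_pow_four (hd : 1 ≤ d) :
    ∃ c : ℝ, ∀ a : E, ∫ v, ⟪v, a⟫ ^ 4 ∂sphereUniform d = c * ‖a‖ ^ 4 := by
  set e₀ : E := EuclideanSpace.single ⟨0, hd⟩ 1 with he₀
  refine ⟨∫ v, ⟪v, e₀⟫ ^ 4 ∂sphereUniform d, fun a => ?_⟩
  have hnorm : ‖a‖ = ‖‖a‖ • e₀‖ := by simp [he₀, norm_smul]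
  set R : E ≃ₗᵢ[ℝ] E := (ℝ ∙ (a - ‖a‖ • e₀))ᗮ.reflection
  have hR : R a = ‖a‖ • e₀ := Submodule.reflection_sub hnorm
  calc ∫ v, ⟪v, a⟫ ^ 4 ∂sphereUniform d
      = ∫ v, ⟪R v, ‖a‖ • e₀⟫ ^ 4 ∂sphereUniform d := by
        simp_rw [← hR, LinearIsometryEquiv.inner_map_map]
    _ = ∫ v, ⟪v, ‖a‖ • e₀⟫ ^ 4 ∂sphereUniform d :=
        (measurePreserving_sphereUniform R).integral_comp
          R.toHomeomorph.measurableEmbedding (fun v => ⟪v, ‖a‖ • e₀⟫ ^ 4)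
    _ = _ := by
        simp_rw [real_inner_smul_right, mul_pow, integral_const_mul]
        ring

theorem exists_integral_inner_mul_four (hd : 1 ≤ d) :
    ∃ κ : ℝ, ∀ a b c e : E,
      ∫ v, ⟪v, a⟫ * ⟪v, b⟫ * ⟪v, c⟫ * ⟪v, e⟫ ∂sphereUniform d =
        κ * (⟪a, b⟫ * ⟪c, e⟫ + ⟪a, c⟫ * ⟪b, e⟫ + ⟪b, c⟫ * ⟪a, e⟫) := by
  obtain ⟨C, hC⟩ := exists_integral_inner_pow_four hd
  refine ⟨C / 3, fun a b c e => ?_⟩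
  -- polarize the quartic form `a ↦ ‖a‖ ^ 4`
  set s : Fin 8 → ℝ := ![1, -1, -1, 1, -1, 1, 1, -1] with hs
  set A : Fin 8 → E := ![a + b + c + e, a + b + c - e, a + b - c + e, a + b - c - e,
    a - b + c + e, a - b + c - e, a - b - c + e, a - b - c - e] with hA
  have hpol : ∀ v : E, ⟪v, a⟫ * ⟪v, b⟫ * ⟪v, c⟫ * ⟪v, e⟫ =
      ∑ i, s i / 192 * ⟪v, A i⟫ ^ 4 := fun v => by
    simp only [hs, hA, Fin.sum_univ_eight, Matrix.cons_val, inner_add_right, inner_sub_right]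
    ring
  simp_rw [hpol]
  rw [integral_finsetSum _ fun i _ =>
    Continuous.integrable_sphereUniform hd (by fun_prop)]
  simp_rw [integral_const_mul, hC]
  have h4 : ∀ x : E, ‖x‖ ^ 4 = ⟪x, x⟫ ^ 2 := fun x => by
    rw [real_inner_self_eq_norm_sq]; ring
  simp_rw [h4]
  simp only [hs, hA, Fin.sum_univ_eight]
  simp only [Matrix.cons_val, inner_add_right, inner_sub_right, inner_add_left, inner_sub_left,
    real_inner_comm a b, real_inner_comm a c, real_inner_comm a e, real_inner_comm b c,
    real_inner_comm b e, real_inner_comm c e]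
  ring

/-- Second and fourth moments of the uniform distribution on the sphere. -/
theorem integral_inner_moments (hd : 1 ≤ d) :
    (∀ a b : E, ∫ v, ⟪v, a⟫ * ⟪v, b⟫ ∂sphereUniform d = 1 / d * ⟪a, b⟫) ∧
    ∀ a b c e : E, ∫ v, ⟪v, a⟫ * ⟪v, b⟫ * ⟪v, c⟫ * ⟪v, e⟫ ∂sphereUniform d =
      1 / (d * (d + 2)) * (⟪a, b⟫ * ⟪c, e⟫ + ⟪a, c⟫ * ⟪b, e⟫ + ⟪b, c⟫ * ⟪a, e⟫) := by
  have := isProbabilityMeasure_sphereUniform hd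
  obtain ⟨κ, hκ⟩ := exists_integral_inner_mul_four hd
  set B := EuclideanSpace.basisFun (Fin d) ℝ
  have hpars : ∀ x y : E, ∑ i, ⟪x, B i⟫ * ⟪y, B i⟫ = ⟪x, y⟫ := fun x y => by
    simpa only [real_inner_comm y] using B.sum_inner_mul_inner x y
  have hdim : ∑ i, ⟪B i, B i⟫ = (d : ℝ) := by simp
  have h2 : ∀ a b : E, ∫ v, ⟪v, a⟫ * ⟪v, b⟫ ∂sphereUniform d = κ * (d + 2) * ⟪a, b⟫ := by
    intro a b
    calc ∫ v, ⟪v, a⟫ * ⟪v, b⟫ ∂sphereUniform d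
        = ∫ v, ∑ i, ⟪v, a⟫ * ⟪v, b⟫ * ⟪v, B i⟫ * ⟪v, B i⟫ ∂sphereUniform d := by
          refine integral_congr_ae ?_
          filter_upwards [ae_sphereUniform_norm_eq_one d] with v hv
          simp_rw [mul_assoc _ ⟪v, B _⟫, ← Finset.mul_sum, hpars]
          simp [hv]
      _ = ∑ i, κ * (⟪a, b⟫ * ⟪B i, B i⟫ + ⟪a, B i⟫ * ⟪b, B i⟫ + ⟪b, B i⟫ * ⟪a, B i⟫) := by
          rw [integral_finsetSum _ fun i _ =>
            Continuous.integrable_sphereUniform hd (by fun_prop)]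
          simp_rw [hκ]
      _ = _ := by
          rw [← Finset.mul_sum, Finset.sum_add_distrib, Finset.sum_add_distrib, hpars, hpars,
            ← Finset.mul_sum, hdim, real_inner_comm a b]
          ring
  have hd0 : (0 : ℝ) < d := by exact_mod_cast hd
  have h1 : (1 : ℝ) = κ * (d + 2) * d := by
    calc (1 : ℝ) = ∫ v, ∑ i, ⟪v, B i⟫ * ⟪v, B i⟫ ∂sphereUniform d := by
          rw [integral_congr_ae (g := fun _ => (1 : ℝ))]
          · simp
          filter_upwards [ae_sphereUniform_norm_eq_one d] with v hv
          simp [hpars, hv]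
      _ = _ := by
          rw [integral_finsetSum _ fun i _ =>
            Continuous.integrable_sphereUniform hd (by fun_prop)]
          simp_rw [h2]
          rw [← Finset.mul_sum, hdim]
  have hκ' : κ = 1 / (d * (d + 2)) := by
    field_simp
    linarith
  refine ⟨fun a b => ?_, fun a b c e => ?_⟩
  · rw [h2, hκ']
    field_simp
  · rw [hκ, hκ']

theorem integral_trilinear_mul_inner (hd : 1 ≤ d) (T : E [×3]→L[ℝ] ℝ) (a : E) :
    ∫ v, T ![v, v, v] * ⟪v, a⟫ ∂sphereUniform d =
      1 / (d * (d + 2)) * ∑ i, (T ![a, EuclideanSpace.single i 1, EuclideanSpace.single i 1] +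
        T ![EuclideanSpace.single i 1, a, EuclideanSpace.single i 1] +
        T ![EuclideanSpace.single i 1, EuclideanSpace.single i 1, a]) := by
  set B := EuclideanSpace.basisFun (Fin d) ℝ
  have hB : ∀ i, EuclideanSpace.single i 1 = B i := by simp [B]
  simp_rw [hB]
  have hrepr : ∀ x : E, x = ∑ i, ⟪x, B i⟫ • B i := fun x => by
    simpa only [real_inner_comm x] using (B.sum_repr' x).symm
  have h₁ : ∀ x y z, T ![x, y, z] = ∑ i, ⟪x, B i⟫ * T ![B i, y, z] := fun x y z => by
    have := congrArg (fun S => S ![y, z]) (congrArg T.curryLeft (hrepr x))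
    simpa using this
  have h₂ : ∀ x y z, T ![x, y, z] = ∑ i, ⟪y, B i⟫ * T ![x, B i, z] := fun x y z => by
    have := congrArg (fun S => S ![z]) (congrArg (T.curryLeft x).curryLeft (hrepr y))
    simpa using this
  have h₃ : ∀ x y z, T ![x, y, z] = ∑ i, ⟪z, B i⟫ * T ![x, y, B i] := fun x y z => by
    have := congrArg (fun S => S ![])
      (congrArg ((T.curryLeft x).curryLeft y).curryLeft (hrepr z))
    simpa using this
  have hexp : ∀ v, T ![v, v, v] * ⟪v, a⟫ = ∑ i, ∑ j, ∑ k,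
      T ![B i, B j, B k] * (⟪v, B i⟫ * ⟪v, B j⟫ * ⟪v, B k⟫ * ⟪v, a⟫) := fun v => by
    rw [h₁, Finset.sum_mul]
    refine Finset.sum_congr rfl fun i _ => ?_
    rw [h₂, Finset.mul_sum, Finset.sum_mul]
    refine Finset.sum_congr rfl fun j _ => ?_
    rw [h₃, Finset.mul_sum, Finset.mul_sum, Finset.sum_mul]
    refine Finset.sum_congr rfl fun k _ => ?_
    ring
  have hint : ∀ g : E → ℝ, Continuous g → Integrable g (sphereUniform d) :=
    fun g hg => hg.integrable_sphereUniform hd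
  calc ∫ v, T ![v, v, v] * ⟪v, a⟫ ∂sphereUniform d
      = ∑ i, ∑ j, ∑ k, T ![B i, B j, B k] * (1 / (d * (d + 2)) *
          (⟪B i, B j⟫ * ⟪B k, a⟫ + ⟪B i, B k⟫ * ⟪B j, a⟫ + ⟪B j, B k⟫ * ⟪B i, a⟫)) := by
        simp_rw [hexp]
        rw [integral_finsetSum _ fun i _ => hint _ (by fun_prop)]
        refine Finset.sum_congr rfl fun i _ => ?_
        rw [integral_finsetSum _ fun j _ => hint _ (by fun_prop)]
        refine Finset.sum_congr rfl fun j _ => ?_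
        rw [integral_finsetSum _ fun k _ => hint _ (by fun_prop)]
        refine Finset.sum_congr rfl fun k _ => ?_
        rw [integral_const_mul, (integral_inner_moments hd).2]
    _ = 1 / (d * (d + 2)) * ((∑ i, ∑ j, ∑ k, if i = j then ⟪a, B k⟫ * T ![B i, B j, B k] else 0) +
          (∑ i, ∑ j, ∑ k, if i = k then ⟪a, B j⟫ * T ![B i, B j, B k] else 0) +
          (∑ i, ∑ j, ∑ k, if j = k then ⟪a, B i⟫ * T ![B i, B j, B k] else 0)) := by
        simp_rw [← Finset.sum_add_distrib, Finset.mul_sum]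
        refine Finset.sum_congr rfl fun i _ => Finset.sum_congr rfl fun j _ =>
          Finset.sum_congr rfl fun k _ => ?_
        simp_rw [orthonormal_iff_ite.1 B.orthonormal, real_inner_comm a]
        split_ifs <;> ring
    _ = _ := by
        simp_rw [Finset.sum_add_distrib]
        have e₃ : ∑ i, T ![B i, B i, a] =
            ∑ i, ∑ j, ∑ k, if i = j then ⟪a, B k⟫ * T ![B i, B j, B k] else 0 := by
          refine Finset.sum_congr rfl fun i _ => ?_
          rw [h₃, Finset.sum_comm]
          simp
        have e₂ : ∑ i, T ![B i, a, B i] =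
            ∑ i, ∑ j, ∑ k, if i = k then ⟪a, B j⟫ * T ![B i, B j, B k] else 0 := by
          refine Finset.sum_congr rfl fun i _ => ?_
          rw [h₂]
          simp
        have e₁ : ∑ i, T ![a, B i, B i] =
            ∑ i, ∑ j, ∑ k, if j = k then ⟪a, B i⟫ * T ![B i, B j, B k] else 0 := by
          rw [Finset.sum_comm' (t' := Finset.univ) (s' := fun _ => Finset.univ) (by simp)]
          refine Finset.sum_congr rfl fun i _ => ?_
          rw [h₁]
          simp
        rw [e₁, e₂, e₃]
        ring

end Moments

section Derivatives

open scoped RealInnerProductSpace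

variable {E : Type*} [NormedAddCommGroup E] [NormedSpace ℝ E] {f : E → ℝ}

theorem ContDiff.iteratedFDeriv_three_swap_left (hf : ContDiff ℝ 3 f) (x a b c : E) :
    iteratedFDeriv ℝ 3 f x ![a, b, c] = iteratedFDeriv ℝ 3 f x ![b, a, c] := by
  have hsymm : IsSymmSndFDerivAt ℝ (fderiv ℝ f) x :=
    (hf.fderiv_right (m := 2) (by norm_num)).contDiffAt.isSymmSndFDerivAt (by simp)
  rw [iteratedFDeriv_succ_apply_right (n := 2), iteratedFDeriv_succ_apply_right (n := 2),
    iteratedFDeriv_two_apply, iteratedFDeriv_two_apply]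
  exact congrArg (fun L : E →L[ℝ] ℝ => L c) (hsymm a b)

theorem ContDiff.iteratedFDeriv_three_swap_right (hf : ContDiff ℝ 3 f) (x a b c : E) :
    iteratedFDeriv ℝ 3 f x ![a, b, c] = iteratedFDeriv ℝ 3 f x ![a, c, b] := by
  have hd := hf.differentiable_iteratedFDeriv (m := 2) (by norm_num) x
  rw [hd.iteratedFDeriv_succ_apply_left', hd.iteratedFDeriv_succ_apply_left']
  congr 2
  funext y
  have hsymm : IsSymmSndFDerivAt ℝ f y := hf.contDiffAt.isSymmSndFDerivAt (by norm_num)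
  rw [iteratedFDeriv_two_apply, iteratedFDeriv_two_apply]
  exact hsymm b c

theorem ContDiff.iteratedDeriv_comp_add_smul {n : ℕ} (hf : ContDiff ℝ n f) (p v : E) {k : ℕ}
    (hk : k ≤ n) :
    iteratedDeriv k (fun t : ℝ => f (p + t • v)) =
      fun t => iteratedFDeriv ℝ k f (p + t • v) fun _ => v := by
  induction k with
  | zero => simp
  | succ k ih =>
    funext t
    have hd := hf.differentiable_iteratedFDeriv (m := k) (by exact_mod_cast hk) (p + t • v)
    have hline : HasDerivAt (fun t : ℝ => p + t • v) v t := by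
      simpa using ((hasDerivAt_id t).smul_const v).const_add p
    rw [iteratedDeriv_succ, ih (by omega), iteratedFDeriv_succ_apply_left]
    exact ((ContinuousMultilinearMap.apply ℝ (fun _ : Fin k => E) ℝ
      fun _ => v).hasFDerivAt.comp_hasDerivAt t (hd.hasFDerivAt.comp_hasDerivAt t hline)).deriv

theorem ContDiff.exists_taylor_four (hf : ContDiff ℝ 4 f) (p v : E) {μ : ℝ} (hμ : 0 < μ) :
    ∃ t ∈ Set.Ioo 0 μ, f (p + μ • v) = f p + μ * fderiv ℝ f p v +
      μ ^ 2 / 2 * iteratedFDeriv ℝ 2 f p ![v, v] +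
      μ ^ 3 / 6 * iteratedFDeriv ℝ 3 f p ![v, v, v] +
      μ ^ 4 / 24 * iteratedFDeriv ℝ 4 f (p + t • v) ![v, v, v, v] := by
  set g : ℝ → ℝ := fun t => f (p + t • v) with hg
  have hgC : ContDiff ℝ 4 g := by fun_prop
  have hD : ∀ k ≤ 4, ∀ t, iteratedDeriv k g t = iteratedFDeriv ℝ k f (p + t • v) fun _ => v :=
    fun k hk t => congrFun (ContDiff.iteratedDeriv_comp_add_smul (n := 4) hf p v hk) t
  obtain ⟨t, ht, h⟩ := taylor_mean_remainder_lagrange_iteratedDeriv (n := 3) hμ.ne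
    (f := g) (by norm_num; exact hgC.contDiffOn)
  rw [Set.uIoo_of_le hμ.le] at ht
  have hW : ∀ k ≤ 4, iteratedDerivWithin k g (Set.uIcc 0 μ) 0 =
      iteratedFDeriv ℝ k f p fun _ => v := fun k hk => by
    rw [iteratedDerivWithin_eq_iteratedDeriv (uniqueDiffOn_uIcc hμ.ne)
      (hgC.contDiffAt.of_le (by exact_mod_cast hk)) Set.left_mem_uIcc, hD k hk]
    simp
  have e2 : (fun _ : Fin 2 => v) = ![v, v] := by ext i; fin_cases i <;> rfl
  have e3 : (fun _ : Fin 3 => v) = ![v, v, v] := by ext i; fin_cases i <;> rfl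
  have e4 : (fun _ : Fin 4 => v) = ![v, v, v, v] := by ext i; fin_cases i <;> rfl
  refine ⟨t, ht, ?_⟩
  rw [taylor_within_apply] at h
  simp only [Finset.sum_range_succ, Finset.sum_range_zero, hW 0 (by norm_num),
    hW 1 (by norm_num), hW 2 (by norm_num), hW 3 (by norm_num), Nat.reduceAdd,
    hD 4 le_rfl, e2, e3, e4, iteratedFDeriv_zero_apply, iteratedFDeriv_one_apply,
    Nat.factorial, smul_eq_mul] at h
  have hgμ : g μ = f (p + μ • v) := rfl
  rw [← hgμ]
  push_cast at h
  linarith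

theorem ContDiff.inner_gradient_laplacian {d : ℕ} {f : EuclideanSpace ℝ (Fin d) → ℝ}
    (hf : ContDiff ℝ 3 f) (p a : EuclideanSpace ℝ (Fin d)) :
    ⟪gradient (laplacian f) p, a⟫ = ∑ i, iteratedFDeriv ℝ 3 f p
      ![a, EuclideanSpace.single i 1, EuclideanSpace.single i 1] := by
  have hd := hf.differentiable_iteratedFDeriv (m := 2) (by norm_num)
  have hdi : ∀ i : Fin d, DifferentiableAt ℝ (fun x => iteratedFDeriv ℝ 2 f x
      ![EuclideanSpace.single i (1 : ℝ), EuclideanSpace.single i 1]) p := fun i =>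
    (hd p).continuousMultilinear_apply_const _
  rw [gradient, InnerProductSpace.toDual_symm_apply]
  unfold laplacian
  rw [fderiv_fun_sum fun i _ => hdi i, sum_apply]
  refine Finset.sum_congr rfl fun i _ => ?_
  rw [(hd p).iteratedFDeriv_succ_apply_left']
  rfl

end Derivatives

section Estimator

open scoped RealInnerProductSpace

variable {d : ℕ} {f : EuclideanSpace ℝ (Fin d) → ℝ}

theorem integral_fderiv_smul_sphereUniform (hd : 1 ≤ d) (p : EuclideanSpace ℝ (Fin d)) :
    ∫ v, fderiv ℝ f p v • v ∂sphereUniform d = (1 / (d : ℝ)) • gradient f p := by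
  refine ext_inner_right ℝ fun a => ?_
  rw [real_inner_comm, ← integral_inner (Continuous.integrable_sphereUniform hd (by fun_prop)),
    real_inner_smul_left, ← (integral_inner_moments hd).1]
  refine integral_congr_ae (.of_forall fun v => ?_)
  simp only [real_inner_smul_right]
  rw [gradient, real_inner_comm _ v, InnerProductSpace.toDual_symm_apply, real_inner_comm a v]

theorem integral_iteratedFDeriv_three_smul_sphereUniform (hd : 1 ≤ d) (hf : ContDiff ℝ 3 f)
    (p : EuclideanSpace ℝ (Fin d)) :
    ∫ v, iteratedFDeriv ℝ 3 f p ![v, v, v] • v ∂sphereUniform d =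
      (3 / ((d : ℝ) * (d + 2))) • gradient (laplacian f) p := by
  refine ext_inner_right ℝ fun a => ?_
  rw [real_inner_comm, ← integral_inner (Continuous.integrable_sphereUniform hd (by fun_prop)),
    real_inner_smul_left, hf.inner_gradient_laplacian]
  have hcomm : ∀ v, ⟪a, iteratedFDeriv ℝ 3 f p ![v, v, v] • v⟫ =
      iteratedFDeriv ℝ 3 f p ![v, v, v] * ⟪v, a⟫ := fun v => by
    rw [real_inner_smul_right, real_inner_comm]
  simp_rw [hcomm]
  rw [integral_trilinear_mul_inner hd]
  have h : ∀ e : EuclideanSpace ℝ (Fin d), iteratedFDeriv ℝ 3 f p ![a, e, e] +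
      iteratedFDeriv ℝ 3 f p ![e, a, e] + iteratedFDeriv ℝ 3 f p ![e, e, a] =
      3 * iteratedFDeriv ℝ 3 f p ![a, e, e] := fun e => by
    rw [hf.iteratedFDeriv_three_swap_right p e e a, hf.iteratedFDeriv_three_swap_left p e a e]
    ring
  simp_rw [h, ← Finset.mul_sum]
  ring

theorem abs_symmetric_difference_sub_le {μ : ℝ} (hμ : 0 < μ) {p : EuclideanSpace ℝ (Fin d)}
    (hf : ContDiff ℝ 4 f) {M₄ : ℝ}
    (hM₄ : ∀ q ∈ Metric.closedBall p μ, ∀ u : EuclideanSpace ℝ (Fin d), ‖u‖ = 1 →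
      |iteratedFDeriv ℝ 4 f q ![u, u, u, u]| ≤ M₄)
    {v : EuclideanSpace ℝ (Fin d)} (hv : ‖v‖ = 1) :
    |(f (p + μ • v) - f (p - μ • v)) / (2 * μ) - fderiv ℝ f p v -
      μ ^ 2 / 6 * iteratedFDeriv ℝ 3 f p ![v, v, v]| ≤ M₄ * μ ^ 3 / 24 := by
  obtain ⟨t, ht, h₁⟩ := hf.exists_taylor_four p v hμ
  obtain ⟨s, hs, h₂⟩ := hf.exists_taylor_four p (-v) hμ
  have hmem : ∀ w : EuclideanSpace ℝ (Fin d), ‖w‖ = 1 → ∀ r ∈ Set.Ioo 0 μ,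
      p + r • w ∈ Metric.closedBall p μ := fun w hw r hr => by
    simp [norm_smul, hw, abs_of_pos hr.1, hr.2.le]
  have b₁ := hM₄ _ (hmem v hv t ht) v hv
  have b₂ := hM₄ _ (hmem (-v) (by simpa using hv) s hs) (-v) (by simpa using hv)
  have n2 : iteratedFDeriv ℝ 2 f p ![-v, -v] = iteratedFDeriv ℝ 2 f p ![v, v] := by
    simp [iteratedFDeriv_two_apply]
  have n3 : iteratedFDeriv ℝ 3 f p ![-v, -v, -v] = -iteratedFDeriv ℝ 3 f p ![v, v, v] := by
    have h := (iteratedFDeriv ℝ 3 f p).map_smul_univ (fun _ => -1) ![v, v, v]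
    have e : (fun i => (-1 : ℝ) • ![v, v, v] i) = ![-v, -v, -v] := by
      ext i; fin_cases i <;> simp
    rw [e] at h
    rw [h]
    norm_num
  rw [smul_neg, ← sub_eq_add_neg, map_neg, n2, n3] at h₂
  rw [h₁, h₂]
  set X := iteratedFDeriv ℝ 4 f (p + t • v) ![v, v, v, v]
  set Y := iteratedFDeriv ℝ 4 f (p + s • -v) ![-v, -v, -v, -v]
  have key : ∀ c L Q K : ℝ, (c + μ * L + μ ^ 2 / 2 * Q + μ ^ 3 / 6 * K + μ ^ 4 / 24 * X -
      (c + μ * -L + μ ^ 2 / 2 * Q + μ ^ 3 / 6 * -K + μ ^ 4 / 24 * Y)) / (2 * μ) - L -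
      μ ^ 2 / 6 * K = μ ^ 3 / 48 * (X - Y) := fun c L Q K => by
    field_simp
    ring
  rw [key, abs_mul, abs_of_pos (by positivity)]
  calc μ ^ 3 / 48 * |X - Y| ≤ μ ^ 3 / 48 * (M₄ + M₄) := by
        gcongr
        exact (abs_sub _ _).trans (add_le_add b₁ b₂)
    _ = M₄ * μ ^ 3 / 24 := by ring

end Estimator

/-- Bias bound for the symmetric two-point zeroth-order estimator:
`‖E_v[ĝ(p;v)] − ∇f(p)/d‖ ≤ (μ²/(2d(d+2)))·‖∇(Δf)(p)‖ + M₄ μ³ / 24`, where the fourth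
derivative has operator norm (sup over unit `u` of `|D⁴f(q)[u,u,u,u]|`) at most `M₄` on the
closed ball of radius `μ` around `p`. -/
theorem zeroth_order_estimator_bias
    (d : ℕ) (hd : 1 ≤ d) (μ : ℝ) (hμ : 0 < μ)
    (p : EuclideanSpace ℝ (Fin d))
    (f : EuclideanSpace ℝ (Fin d) → ℝ) (hf : ContDiff ℝ 4 f) (M₄ : ℝ)
    (hM₄ : ∀ q ∈ Metric.closedBall p μ, ∀ u : EuclideanSpace ℝ (Fin d), ‖u‖ = 1 →
      |iteratedFDeriv ℝ 4 f q ![u, u, u, u]| ≤ M₄) :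
    ‖(∫ v : EuclideanSpace ℝ (Fin d),
          ((f (p + μ • v) - f (p - μ • v)) / (2 * μ)) • v ∂(sphereUniform d)) -
        (1 / (d : ℝ)) • gradient f p‖ ≤
      μ ^ 2 / (2 * (d : ℝ) * (d + 2)) * ‖gradient (laplacian f) p‖ +
        M₄ * μ ^ 3 / 24 := by
  have := isProbabilityMeasure_sphereUniform hd
  have hf3 : ContDiff ℝ 3 f := hf.of_le (by norm_num)
  have hc : Continuous f := hf.continuous
  set T := iteratedFDeriv ℝ 3 f p
  have hbound : ‖∫ v, ((f (p + μ • v) - f (p - μ • v)) / (2 * μ) - fderiv ℝ f p v -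
      μ ^ 2 / 6 * T ![v, v, v]) • v ∂sphereUniform d‖ ≤ M₄ * μ ^ 3 / 24 := by
    refine (norm_integral_le_of_norm_le_const (C := M₄ * μ ^ 3 / 24) ?_).trans (by simp)
    filter_upwards [ae_sphereUniform_norm_eq_one d] with v hv
    rw [norm_smul, hv, mul_one, Real.norm_eq_abs]
    exact abs_symmetric_difference_sub_le hμ hf hM₄ hv
  have hF : Integrable (fun v => ((f (p + μ • v) - f (p - μ • v)) / (2 * μ)) • v)
      (sphereUniform d) :=
    Continuous.integrable_sphereUniform hd (by fun_prop)
  have hL : Integrable (fun v => fderiv ℝ f p v • v) (sphereUniform d) :=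
    Continuous.integrable_sphereUniform hd (by fun_prop)
  have hFL : Integrable (fun v => ((f (p + μ • v) - f (p - μ • v)) / (2 * μ)) • v -
      fderiv ℝ f p v • v) (sphereUniform d) := hF.sub hL
  have hT : Integrable (fun v => (μ ^ 2 / 6) • T ![v, v, v] • v) (sphereUniform d) :=
    Continuous.integrable_sphereUniform hd (by fun_prop)
  simp_rw [sub_smul, mul_smul] at hbound
  rw [integral_sub hFL hT, integral_sub hF hL, integral_smul,
    integral_fderiv_smul_sphereUniform hd,
    integral_iteratedFDeriv_three_smul_sphereUniform hd hf3, smul_smul] at hbound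
  have hd0 : (0 : ℝ) < d := by exact_mod_cast hd
  have hcoef : μ ^ 2 / 6 * (3 / ((d : ℝ) * (d + 2))) = μ ^ 2 / (2 * d * (d + 2)) := by
    field_simp
    norm_num
  rw [hcoef] at hbound
  refine (norm_le_norm_add_norm_sub' _ _).trans (add_le_add (le_of_eq ?_) hbound)
  rw [norm_smul, Real.norm_of_nonneg (by positivity)]
end
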